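/- Let f : (-1,1) → ℝ be measurable with f(x)·(1-x²)^{1/4} ∈ L²(-1,1), and define g : [-π, π] → ℝ by g(θ) = f(cos θ)·|sin θ|. Then for every ψ ∈ (0, π), setting x = cos ψ, whenever either principal value exists one has (1/π) p.v. ∫_{-1}^{1} f(y)/(x-y) dy = −(1/(2 sin ψ)) · (1/π) p.v. ∫_{-π}^{π} g(θ) cot((ψ − θ)/2) dθ; that is, the finite Hilbert transform of f at cos ψ equals −1/(2 sin ψ) times the conjugate-function integral of g at ψ. -/

import Mathlib

open MeasureTheory Filter Set Real

/-- The truncated finite Hilbert transform of `f` on `(-1,1)` at `x`. -/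
noncomputable def truncatedFiniteHilbert (f : ℝ → ℝ) (x ε : ℝ) : ℝ :=
  (1 / π) * ∫ y in Ioo (-1 : ℝ) 1 \ Ioo (x - ε) (x + ε), f y / (x - y)

/-- The truncated conjugate-function integral of `g` at `ψ`, over
`{θ ∈ (-π, π) : |ψ - θ| > ε}`, with the normalization `1/π`. -/
noncomputable def truncatedConjugate (g : ℝ → ℝ) (ψ ε : ℝ) : ℝ :=
  (1 / π) * ∫ θ in {θ : ℝ | θ ∈ Ioo (-π) π ∧ ε < |ψ - θ|},
    g θ * Real.cot ((ψ - θ) / 2)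

theorem abs_cos_sub_cos_sub_sin_mul_le (ψ θ : ℝ) :
    |cos ψ - cos θ - sin ψ * (θ - ψ)| ≤ 3 * (θ - ψ) ^ 2 := by
  obtain ⟨t, rfl⟩ : ∃ t, θ = ψ + t := ⟨θ - ψ, by ring⟩
  have hcos : |1 - cos t| ≤ t ^ 2 := by
    rw [abs_of_nonneg (by linarith [cos_le_one t])]
    linarith [one_sub_sq_div_two_le_cos (x := t), sq_nonneg t]
  have hsin : |sin t - t| ≤ 2 * t ^ 2 := by
    rcases le_or_gt |t| 1 with h | h
    · have h1 := abs_le.1 (sin_bound h)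
      have h2 : |t| ^ 5 ≤ t ^ 2 := by
        rw [← sq_abs t]
        exact pow_le_pow_of_le_one (abs_nonneg t) h (by norm_num)
      have h3 : |t ^ 3| ≤ t ^ 2 := by
        rw [abs_pow, ← sq_abs t]
        exact pow_le_pow_of_le_one (abs_nonneg t) h (by norm_num)
      have h4 := abs_le.1 h3
      have h5 := sq_nonneg t
      rw [abs_le]
      constructor <;> linarith [h1.1, h1.2, h4.1, h4.2]
    · have h1 : |sin t - t| ≤ |sin t| + |t| := abs_sub _ _
      have h2 : |t| ≤ t ^ 2 := by
        rw [← sq_abs t]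
        nlinarith
      linarith [abs_sin_le_abs (x := t)]
  have key : cos ψ - cos (ψ + t) - sin ψ * (ψ + t - ψ)
      = cos ψ * (1 - cos t) + sin ψ * (sin t - t) := by
    rw [cos_add]
    ring
  rw [key]
  calc _ ≤ |cos ψ * (1 - cos t)| + |sin ψ * (sin t - t)| := abs_add_le _ _
    _ ≤ 1 * t ^ 2 + 1 * (2 * t ^ 2) := by
      rw [abs_mul, abs_mul]
      gcongr
      · exact abs_cos_le_one ψ
      · exact abs_sin_le_one ψ
    _ = 3 * (ψ + t - ψ) ^ 2 := by ring

theorem exists_mul_abs_sub_le_abs_cos_sub_cos {ψ : ℝ} (hψ : ψ ∈ Ioo 0 π) :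
    ∃ c > 0, ∀ θ ∈ Ioo 0 π, c * |ψ - θ| ≤ |cos ψ - cos θ| := by
  obtain ⟨h0, hπ⟩ := hψ
  have hm : 0 < min (sin (ψ / 2)) (cos (ψ / 2)) :=
    lt_min (sin_pos_of_pos_of_lt_pi (by linarith) (by linarith))
      (cos_pos_of_mem_Ioo ⟨by linarith, by linarith⟩)
  set m := min (sin (ψ / 2)) (cos (ψ / 2)) with hmdef
  refine ⟨2 / π * m, by positivity, fun θ hθ => ?_⟩
  have h1 : m ≤ sin ((ψ + θ) / 2) := by
    rcases le_total ((ψ + θ) / 2) (π / 2) with h | h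
    · exact (min_le_left _ _).trans
        (sin_le_sin_of_le_of_le_pi_div_two (by linarith) h (by linarith [hθ.1]))
    · refine (min_le_right _ _).trans ?_
      rw [← cos_sub_pi_div_two]
      exact cos_le_cos_of_nonneg_of_le_pi (by linarith) (by linarith) (by linarith [hθ.2])
  have h2 : 2 / π * (|ψ - θ| / 2) ≤ |sin ((ψ - θ) / 2)| := by
    have hb : |ψ - θ| / 2 ≤ π / 2 := by
      have : |ψ - θ| ≤ π := abs_le.2 ⟨by linarith [hθ.2], by linarith [hθ.1]⟩
      linarith
    have := mul_le_sin (by positivity) hb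
    refine this.trans ?_
    rcases abs_cases (ψ - θ) with ⟨h, -⟩ | ⟨h, -⟩
    · rw [h]
      exact le_abs_self _
    · rw [h, neg_div, sin_neg]
      exact neg_le_abs _
  rw [cos_sub_cos, abs_mul, abs_mul]
  have h3 : m ≤ |sin ((ψ + θ) / 2)| := h1.trans (le_abs_self _)
  have h4 : m * (2 / π * (|ψ - θ| / 2)) ≤ |sin ((ψ + θ) / 2)| * |sin ((ψ - θ) / 2)| := by
    gcongr
  rw [abs_neg, abs_two]
  linarith

/-- Where exactly one of the truncations `δ < |ψ - θ|` and `δ * sin ψ ≤ |cos ψ - cos θ|` holds,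
`θ` is within `O(δ ^ 2)` of `ψ ± δ`, and `cos θ` is at distance at least of order `δ`
from `cos ψ`. -/
theorem exists_bounds_of_truncations_differ {ψ : ℝ} (hψ : ψ ∈ Ioo 0 π) :
    ∃ a > 0, ∃ C > 0, ∀ δ > 0, ∀ θ ∈ Ioo 0 π,
      (δ < |ψ - θ| ∧ |cos ψ - cos θ| < δ * sin ψ ∨
        |ψ - θ| ≤ δ ∧ δ * sin ψ ≤ |cos ψ - cos θ|) →
      a * δ ≤ |cos ψ - cos θ| ∧ |(|ψ - θ| - δ)| ≤ C * δ ^ 2 := by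
  obtain ⟨c, hc, hlow⟩ := exists_mul_abs_sub_le_abs_cos_sub_cos hψ
  have hs : 0 < sin ψ := sin_pos_of_mem_Ioo hψ
  have hs1 := sin_le_one ψ
  refine ⟨min c (sin ψ), lt_min hc hs, 3 / (c ^ 2 * sin ψ) + 3 / sin ψ, by positivity,
    fun δ hδ θ hθ h => ?_⟩
  have hl := hlow θ hθ
  have hT := abs_le.1 (abs_cos_sub_cos_sub_sin_mul_le ψ θ)
  have hsq : (θ - ψ) ^ 2 = |ψ - θ| ^ 2 := by
    rw [sq_abs]
    ring
  rw [hsq] at hT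
  have hup : |cos ψ - cos θ| ≤ sin ψ * |ψ - θ| + 3 * |ψ - θ| ^ 2 := by
    have h1 := le_abs_self (ψ - θ)
    have h2 := neg_le_abs (ψ - θ)
    rw [abs_le]
    constructor <;> nlinarith [hT.1, hT.2]
  have hdown : sin ψ * |ψ - θ| ≤ |cos ψ - cos θ| + 3 * |ψ - θ| ^ 2 := by
    have h1 := le_abs_self (cos ψ - cos θ)
    have h2 := neg_le_abs (cos ψ - cos θ)
    rcases abs_cases (ψ - θ) with ⟨h, -⟩ | ⟨h, -⟩ <;> rw [h] at hT ⊢ <;> nlinarith [hT.1, hT.2]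
  set t := |ψ - θ| with ht
  have ht0 : 0 ≤ t := abs_nonneg _
  have hA : 0 ≤ 3 / (c ^ 2 * sin ψ) * δ ^ 2 := by positivity
  have hB : 0 ≤ 3 / sin ψ * δ ^ 2 := by positivity
  rcases h with ⟨h1, h2⟩ | ⟨h1, h2⟩
  · constructor
    · calc min c (sin ψ) * δ ≤ c * t := by
            gcongr
            exact min_le_left _ _
        _ ≤ _ := hl
    · have h3 : c * t ≤ δ := by nlinarith
      have h4 : (c * t) ^ 2 ≤ δ ^ 2 := by gcongr
      have h5 : t - δ ≤ 3 / (c ^ 2 * sin ψ) * δ ^ 2 := by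
        rw [div_mul_eq_mul_div, le_div_iff₀ (by positivity)]
        have : (t - δ) * sin ψ ≤ 3 * t ^ 2 := by linarith
        nlinarith [sq_nonneg c]
      rw [abs_of_pos (by linarith), add_mul]
      linarith
  · constructor
    · calc min c (sin ψ) * δ ≤ δ * sin ψ := by
            rw [mul_comm]
            gcongr
            exact min_le_right _ _
        _ ≤ _ := h2
    · have h4 : t ^ 2 ≤ δ ^ 2 := by gcongr
      have h5 : δ - t ≤ 3 / sin ψ * δ ^ 2 := by
        rw [div_mul_eq_mul_div, le_div_iff₀ hs]
        linarith
      rw [abs_of_nonpos (by linarith), add_mul]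
      linarith

/-- If `G` and `G ^ 2` are integrable and `μ (E δ) = O(δ ^ 2)`, then
`∫ x in E δ, |G x| ∂μ = o(δ)`. -/
theorem tendsto_inv_mul_setIntegral_abs {α : Type*} [MeasurableSpace α] {μ : Measure α}
    {G : α → ℝ} (hG : Integrable G μ) (hG2 : Integrable (fun x => G x ^ 2) μ)
    {E : ℝ → Set α} {K : ℝ} (hK : 0 ≤ K)
    (hE : ∀ δ > 0, μ (E δ) ≤ ENNReal.ofReal (K * δ ^ 2)) :
    Tendsto (fun δ => δ⁻¹ * ∫ x in E δ, |G x| ∂μ) (nhdsWithin 0 (Ioi 0)) (nhds 0) := by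
  have hid : Tendsto (fun δ : ℝ => δ) (nhdsWithin 0 (Ioi 0)) (nhds 0) :=
    tendsto_id.mono_left nhdsWithin_le_nhds
  have hμ : Tendsto (μ ∘ E) (nhdsWithin 0 (Ioi 0)) (nhds 0) := by
    have h1 : Tendsto (fun δ : ℝ => ENNReal.ofReal (K * δ ^ 2)) (nhdsWithin 0 (Ioi 0))
        (nhds 0) := by
      simpa using ENNReal.tendsto_ofReal ((hid.pow 2).const_mul K)
    refine tendsto_of_tendsto_of_tendsto_of_le_of_le' tendsto_const_nhds h1
      (Eventually.of_forall fun _ => zero_le) ?_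
    filter_upwards [self_mem_nhdsWithin] with δ hδ using hE δ hδ
  have hI := hG2.tendsto_setIntegral_nhds_zero hμ
  set I : ℝ → ℝ := fun δ => ∫ x in E δ, G x ^ 2 ∂μ with hIdef
  have hη : Tendsto (fun δ => (K / 2 + 1 / 2) * (√(I δ) + δ)) (nhdsWithin 0 (Ioi 0))
      (nhds 0) := by
    have h1 : Tendsto (fun δ => √(I δ)) (nhdsWithin 0 (Ioi 0)) (nhds 0) := by
      simpa [Function.comp_def] using (continuous_sqrt.tendsto 0).comp hI
    simpa using (h1.add hid).const_mul (K / 2 + 1 / 2)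
  refine tendsto_of_tendsto_of_tendsto_of_le_of_le' tendsto_const_nhds hη ?_ ?_
  · filter_upwards [self_mem_nhdsWithin] with δ hδ
    have : (0 : ℝ) < δ := hδ
    have : 0 ≤ ∫ x in E δ, |G x| ∂μ := integral_nonneg fun _ => abs_nonneg _
    positivity
  · filter_upwards [self_mem_nhdsWithin] with δ hδ
    have hδ : 0 < δ := hδ
    have hI0 : 0 ≤ I δ := integral_nonneg fun _ => sq_nonneg _
    set η := √(I δ) + δ with hηdef
    have hη0 : 0 < η := by positivity
    have hIη : I δ ≤ η ^ 2 := by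
      have := sq_sqrt hI0
      have := sqrt_nonneg (I δ)
      nlinarith
    have hfin : μ (E δ) < ⊤ := (hE δ hδ).trans_lt ENNReal.ofReal_lt_top
    have hvol : μ.real (E δ) ≤ K * δ ^ 2 :=
      ENNReal.toReal_le_of_le_ofReal (by positivity) (hE δ hδ)
    have hconst : IntegrableOn (fun _ => η / (2 * δ)) (E δ) μ :=
      integrableOn_const hfin.ne
    have hsq : IntegrableOn (fun x => δ / (2 * η) * G x ^ 2) (E δ) μ :=
      (hG2.const_mul _).integrableOn
    have hle : ∫ x in E δ, |G x| ∂μ ≤ ∫ x in E δ, (η / (2 * δ) + δ / (2 * η) * G x ^ 2) ∂μ := by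
      refine integral_mono hG.abs.integrableOn (hconst.add hsq) fun x => ?_
      have h1 : 0 ≤ (η - δ * |G x|) ^ 2 := sq_nonneg _
      have h2 : η / (2 * δ) + δ / (2 * η) * G x ^ 2 - |G x|
          = (η - δ * |G x|) ^ 2 / (2 * δ * η) := by
        rw [← sq_abs (G x)]
        field_simp
        ring
      have h3 : 0 ≤ (η - δ * |G x|) ^ 2 / (2 * δ * η) := by positivity
      simp only
      linarith
    have heq : ∫ x in E δ, (η / (2 * δ) + δ / (2 * η) * G x ^ 2) ∂μ
        = μ.real (E δ) * (η / (2 * δ)) + δ / (2 * η) * I δ := by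
      rw [integral_add hconst hsq, setIntegral_const, integral_const_mul, smul_eq_mul]
    calc δ⁻¹ * ∫ x in E δ, |G x| ∂μ
        ≤ δ⁻¹ * (K * δ ^ 2 * (η / (2 * δ)) + δ / (2 * η) * η ^ 2) := by
          rw [heq] at hle
          gcongr
          refine hle.trans ?_
          gcongr
      _ = (K / 2 + 1 / 2) * η := by
          field_simp

theorem integrableOn_div_of_le_abs {α : Type*} [MeasurableSpace α] {μ : Measure α}
    {W : Set α} (hW : MeasurableSet W) {g D : α → ℝ} (hg : IntegrableOn g W μ)
    (hD : Measurable D) {b : ℝ} (hb : 0 < b) (hbD : ∀ x ∈ W, b ≤ |D x|) :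
    IntegrableOn (fun x => g x / D x) W μ := by
  refine Integrable.mono' (hg.abs.const_mul b⁻¹)
    (hg.aestronglyMeasurable.div₀ hD.aestronglyMeasurable) ?_
  filter_upwards [ae_restrict_mem hW] with x hx
  rw [norm_div, Real.norm_eq_abs, Real.norm_eq_abs, div_eq_inv_mul]
  gcongr
  exact hbD x hx

theorem abs_setIntegral_div_le {α : Type*} [MeasurableSpace α] {μ : Measure α}
    {W E : Set α} (hW : MeasurableSet W) (hWE : W ⊆ E) {g D : α → ℝ} (hg : Integrable g μ)
    {b : ℝ} (hb : 0 < b) (hbD : ∀ x ∈ W, b ≤ |D x|) :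
    |∫ x in W, g x / D x ∂μ| ≤ b⁻¹ * ∫ x in E, |g x| ∂μ := by
  rw [← integral_const_mul]
  have hint := hg.abs.const_mul b⁻¹
  calc |∫ x in W, g x / D x ∂μ| ≤ ∫ x in W, b⁻¹ * |g x| ∂μ := by
        rw [← Real.norm_eq_abs]
        refine norm_integral_le_of_norm_le hint.integrableOn ?_
        filter_upwards [ae_restrict_mem hW] with x hx
        rw [norm_div, Real.norm_eq_abs, Real.norm_eq_abs, div_eq_inv_mul]
        gcongr
        exact hbD x hx
    _ ≤ _ := setIntegral_mono_set hint.integrableOn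
        (Eventually.of_forall fun x => by positivity) hWE.eventuallyLE

theorem volume_abs_abs_sub_sub_le (ψ δ r : ℝ) :
    volume {θ : ℝ | |(|ψ - θ| - δ)| ≤ r} ≤ ENNReal.ofReal (4 * r) := by
  have hsub : {θ : ℝ | |(|ψ - θ| - δ)| ≤ r}
      ⊆ Icc (ψ + δ - r) (ψ + δ + r) ∪ Icc (ψ - δ - r) (ψ - δ + r) := by
    intro θ hθ
    have h := abs_le.1 (show |(|ψ - θ| - δ)| ≤ r from hθ)
    rcases abs_cases (ψ - θ) with ⟨h1, -⟩ | ⟨h1, -⟩ <;> rw [h1] at h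
    · exact Or.inr ⟨by linarith, by linarith⟩
    · exact Or.inl ⟨by linarith, by linarith⟩
  rcases lt_or_ge r 0 with hr | hr
  · rw [show {θ : ℝ | |(|ψ - θ| - δ)| ≤ r} = ∅ from
      eq_empty_of_forall_notMem fun θ hθ =>
        absurd ((abs_nonneg _).trans (show |(|ψ - θ| - δ)| ≤ r from hθ)) (not_le.2 hr)]
    simp
  · calc _ ≤ _ := measure_mono hsub
      _ ≤ _ := measure_union_le _ _
      _ = ENNReal.ofReal (4 * r) := by
        rw [Real.volume_Icc, Real.volume_Icc, ← ENNReal.ofReal_add (by linarith) (by linarith)]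
        ring_nf

/-- The principal-value truncations `δ < |ψ - θ|` and `δ * sin ψ ≤ |cos ψ - cos θ|` are
equivalent for a square integrable density. -/
theorem tendsto_setIntegral_truncations_sub {ψ : ℝ} (hψ : ψ ∈ Ioo 0 π) {g : ℝ → ℝ}
    (hg : IntegrableOn g (Ioo 0 π)) (hg2 : IntegrableOn (fun θ => g θ ^ 2) (Ioo 0 π)) :
    Tendsto (fun δ =>
      (∫ θ in Ioo 0 π ∩ {θ | δ < |ψ - θ|}, g θ / (cos ψ - cos θ))
        - ∫ θ in Ioo 0 π ∩ {θ | δ * sin ψ ≤ |cos ψ - cos θ|}, g θ / (cos ψ - cos θ))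
      (nhdsWithin 0 (Ioi 0)) (nhds 0) := by
  obtain ⟨a, ha, C, hC, hdiff⟩ := exists_bounds_of_truncations_differ hψ
  obtain ⟨c, hc, hlow⟩ := exists_mul_abs_sub_le_abs_cos_sub_cos hψ
  have hs : 0 < sin ψ := sin_pos_of_mem_Ioo hψ
  set E : ℝ → Set ℝ := fun δ => {θ | |(|ψ - θ| - δ)| ≤ C * δ ^ 2} with hE
  have hmain := (tendsto_inv_mul_setIntegral_abs (μ := volume.restrict (Ioo 0 π)) hg hg2
    (E := E) (K := 4 * C) (by positivity) (fun δ _ => by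
      refine (Measure.restrict_apply_le _ _).trans ((volume_abs_abs_sub_sub_le ψ δ _).trans_eq ?_)
      ring_nf)).const_mul (2 * a⁻¹)
  rw [mul_zero] at hmain
  refine squeeze_zero_norm' ?_ hmain
  filter_upwards [self_mem_nhdsWithin] with δ hδ
  have hδ : 0 < δ := hδ
  set D : ℝ → ℝ := fun θ => cos ψ - cos θ with hD
  have hDm : Measurable D := by fun_prop
  set S : Set ℝ := {θ | δ < |ψ - θ|} with hS
  set R : Set ℝ := {θ | δ * sin ψ ≤ |cos ψ - cos θ|} with hR
  have hΩ : MeasurableSet (Ioo 0 π) := measurableSet_Ioo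
  have hSm : MeasurableSet S := measurableSet_lt (by fun_prop) (by fun_prop)
  have hRm : MeasurableSet R := measurableSet_le (by fun_prop) (by fun_prop)
  have hSi : IntegrableOn (fun θ => g θ / D θ) (Ioo 0 π ∩ S) :=
    integrableOn_div_of_le_abs (hΩ.inter hSm) (hg.mono_set inter_subset_left) hDm
      (b := c * δ) (by positivity) fun θ hθ =>
        (mul_le_mul_of_nonneg_left (le_of_lt hθ.2) hc.le).trans (hlow θ hθ.1)
  have hRi : IntegrableOn (fun θ => g θ / D θ) (Ioo 0 π ∩ R) :=
    integrableOn_div_of_le_abs (hΩ.inter hRm) (hg.mono_set inter_subset_left) hDm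
      (b := δ * sin ψ) (by positivity) fun θ hθ => hθ.2
  have h1 := integral_inter_add_sdiff hRm hSi
  have h2 := integral_inter_add_sdiff hSm hRi
  rw [inter_right_comm] at h2
  have bound : ∀ W ⊆ Ioo 0 π, MeasurableSet W →
      (∀ θ ∈ W, δ < |ψ - θ| ∧ |cos ψ - cos θ| < δ * sin ψ ∨
        |ψ - θ| ≤ δ ∧ δ * sin ψ ≤ |cos ψ - cos θ|) →
      |∫ θ in W, g θ / D θ| ≤ (a * δ)⁻¹ * ∫ θ in E δ, |g θ| ∂(volume.restrict (Ioo 0 π)) := by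
    intro W hW hWm h
    have := abs_setIntegral_div_le (μ := volume.restrict (Ioo 0 π)) hWm (E := E δ)
      (fun θ hθ => (hdiff δ hδ θ (hW hθ) (h θ hθ)).2) hg (D := D) (b := a * δ)
      (by positivity) fun θ hθ => (hdiff δ hδ θ (hW hθ) (h θ hθ)).1
    rwa [Measure.restrict_restrict hWm, inter_eq_left.2 hW] at this
  have hb1 := bound ((Ioo 0 π ∩ S) \ R) (fun θ hθ => hθ.1.1) ((hΩ.inter hSm).diff hRm)
    fun θ hθ => Or.inl ⟨hθ.1.2, not_le.1 hθ.2⟩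
  have hb2 := bound ((Ioo 0 π ∩ R) \ S) (fun θ hθ => hθ.1.1) ((hΩ.inter hRm).diff hSm)
    fun θ hθ => Or.inr ⟨not_lt.1 hθ.2, hθ.1.2⟩
  rw [← h1, ← h2, add_sub_add_left_eq_sub, Real.norm_eq_abs]
  refine (abs_sub _ _).trans ((add_le_add hb1 hb2).trans_eq ?_)
  rw [mul_inv]
  ring

theorem image_cos_Ioo_zero_pi : cos '' Ioo 0 π = Ioo (-1) 1 := by
  apply Subset.antisymm
  · rintro _ ⟨θ, hθ, rfl⟩
    constructor
    · rw [← cos_pi]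
      exact cos_lt_cos_of_nonneg_of_le_pi hθ.1.le le_rfl hθ.2
    · rw [← cos_zero]
      exact cos_lt_cos_of_nonneg_of_le_pi le_rfl hθ.2.le hθ.1
  · intro y hy
    refine ⟨arccos y, ⟨arccos_pos.2 hy.2, ?_⟩, cos_arccos hy.1.le hy.2.le⟩
    refine lt_of_le_of_ne (arccos_le_pi y) fun h => ?_
    exact absurd (arccos_eq_pi.1 h) (not_le.2 hy.1)

theorem integrableOn_Ioo_iff_comp_cos (F : ℝ → ℝ) :
    IntegrableOn F (Ioo (-1) 1) ↔ IntegrableOn (fun θ => F (cos θ) * |sin θ|) (Ioo 0 π) := by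
  rw [← image_cos_Ioo_zero_pi, integrableOn_image_iff_integrableOn_abs_deriv_smul
    measurableSet_Ioo (fun θ _ => (hasDerivAt_cos θ).hasDerivWithinAt)
    (injOn_cos.mono Ioo_subset_Icc_self)]
  simp only [abs_neg, smul_eq_mul, mul_comm]

theorem setIntegral_image_cos (F : ℝ → ℝ) {s : Set ℝ} (hs : MeasurableSet s)
    (hsub : s ⊆ Ioo 0 π) :
    ∫ y in cos '' s, F y = ∫ θ in s, F (cos θ) * |sin θ| := by
  rw [integral_image_eq_integral_abs_deriv_smul hs
    (fun θ _ => (hasDerivAt_cos θ).hasDerivWithinAt)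
    (injOn_cos.mono (hsub.trans Ioo_subset_Icc_self))]
  simp only [abs_neg, smul_eq_mul, mul_comm]

theorem sq_comp_cos_mul_abs_sin (f : ℝ → ℝ) (θ : ℝ) :
    (f (cos θ) * |sin θ|) ^ 2 = f (cos θ) ^ 2 * √(1 - cos θ ^ 2) * |sin θ| := by
  rw [← abs_sin_eq_sqrt_one_sub_cos_sq]
  ring

theorem integrableOn_Ioo_of_sq_mul_sqrt {f : ℝ → ℝ}
    (hmeas : AEStronglyMeasurable f (volume.restrict (Ioo (-1 : ℝ) 1)))
    (hL2 : IntegrableOn (fun x => f x ^ 2 * √(1 - x ^ 2)) (Ioo (-1 : ℝ) 1)) :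
    IntegrableOn f (Ioo (-1 : ℝ) 1) := by
  have hw : IntegrableOn (fun x : ℝ => (√(1 - x ^ 2))⁻¹) (Ioo (-1) 1) := by
    rw [integrableOn_Ioo_iff_comp_cos]
    have h1 : IntegrableOn (fun _ : ℝ => (1 : ℝ)) (Ioo 0 π) :=
      integrableOn_const (by simp)
    refine h1.congr_fun (fun θ hθ => ?_) measurableSet_Ioo
    have : 0 < sin θ := sin_pos_of_mem_Ioo hθ
    simp only
    rw [← abs_sin_eq_sqrt_one_sub_cos_sq, inv_mul_cancel₀ (by positivity)]
  refine Integrable.mono' (hL2.add hw) hmeas ?_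
  filter_upwards [ae_restrict_mem measurableSet_Ioo] with x hx
  have hpos : 0 < √(1 - x ^ 2) := sqrt_pos.2 (by nlinarith [hx.1, hx.2])
  set w := √(1 - x ^ 2) with hwdef
  have h1 : f x ^ 2 * w + w⁻¹ - |f x| = ((|f x| * w - 1) ^ 2 + |f x| * w) / w := by
    rw [← sq_abs (f x)]
    field_simp
    ring
  have h2 : 0 ≤ ((|f x| * w - 1) ^ 2 + |f x| * w) / w := by positivity
  rw [Real.norm_eq_abs, Pi.add_apply]
  linarith

theorem cot_add_cot_half {ψ θ : ℝ} (hψ : ψ ∈ Ioo 0 π) (hθ : θ ∈ Ioo 0 π) (hne : θ ≠ ψ) :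
    Real.cot ((ψ - θ) / 2) + Real.cot ((ψ + θ) / 2) = -(2 * sin ψ) / (cos ψ - cos θ) := by
  have h1 : sin ((ψ + θ) / 2) ≠ 0 :=
    (sin_pos_of_pos_of_lt_pi (by linarith [hψ.1, hθ.1]) (by linarith [hψ.2, hθ.2])).ne'
  have h2 : sin ((ψ - θ) / 2) ≠ 0 := by
    intro h
    rw [sin_eq_zero_iff_of_lt_of_lt (by linarith [hψ.1, hθ.2, pi_pos])
      (by linarith [hψ.2, hθ.1, pi_pos])] at h
    exact hne (by linarith)
  have h3 : sin ψ = sin ((ψ - θ) / 2) * cos ((ψ + θ) / 2)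
      + cos ((ψ - θ) / 2) * sin ((ψ + θ) / 2) := by
    rw [← sin_add]
    ring_nf
  rw [Real.cot_eq_cos_div_sin, Real.cot_eq_cos_div_sin, cos_sub_cos, h3]
  field_simp
  ring

theorem integrableOn_mul_cot {ψ : ℝ} {g : ℝ → ℝ} {W K : Set ℝ} (hg : IntegrableOn g W)
    (hW : MeasurableSet W) (hK : IsCompact K) (hWK : W ⊆ K)
    (hne : ∀ θ ∈ K, sin ((ψ - θ) / 2) ≠ 0) :
    IntegrableOn (fun θ => g θ * Real.cot ((ψ - θ) / 2)) W := by
  refine hg.mul_continuousOn_of_subset ?_ hW hK hWK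
  simp only [Real.cot_eq_cos_div_sin]
  exact ContinuousOn.div (by fun_prop) (by fun_prop) hne

theorem truncatedFiniteHilbert_cos (f : ℝ → ℝ) (ψ ε : ℝ) :
    truncatedFiniteHilbert f (cos ψ) ε
      = 1 / π * ∫ θ in Ioo 0 π ∩ {θ | ε ≤ |cos ψ - cos θ|},
          f (cos θ) * |sin θ| / (cos ψ - cos θ) := by
  have himage : Ioo (-1 : ℝ) 1 \ Ioo (cos ψ - ε) (cos ψ + ε)
      = cos '' (Ioo 0 π ∩ {θ | ε ≤ |cos ψ - cos θ|}) := by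
    rw [← image_cos_Ioo_zero_pi]
    have hmem : ∀ y, y ∉ Ioo (cos ψ - ε) (cos ψ + ε) ↔ ε ≤ |cos ψ - y| := by
      intro y
      rw [← not_lt, not_iff_not, abs_lt, mem_Ioo]
      constructor <;> rintro ⟨h1, h2⟩ <;> constructor <;> linarith
    ext y
    constructor
    · rintro ⟨⟨θ, hθ, rfl⟩, hy⟩
      exact ⟨θ, ⟨hθ, (hmem _).1 hy⟩, rfl⟩
    · rintro ⟨θ, ⟨hθ, hθ2⟩, rfl⟩
      exact ⟨⟨θ, hθ, rfl⟩, (hmem _).2 hθ2⟩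
  have hm : MeasurableSet {θ | ε ≤ |cos ψ - cos θ|} :=
    measurableSet_le (by fun_prop) (by fun_prop)
  rw [truncatedFiniteHilbert, himage,
    setIntegral_image_cos _ (measurableSet_Ioo.inter hm) inter_subset_left]
  simp only [div_mul_eq_mul_div]

theorem truncatedConjugate_even {ψ : ℝ} (hψ : ψ ∈ Ioo 0 π) {g : ℝ → ℝ}
    (heven : ∀ θ, g (-θ) = g θ) (hg : IntegrableOn g (Ioo 0 π)) {δ : ℝ} (hδ : 0 < δ)
    (hδψ : δ < ψ) :
    truncatedConjugate g ψ δ = 1 / π *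
      (-(2 * sin ψ) * (∫ θ in Ioo 0 π ∩ {θ | δ < |ψ - θ|}, g θ / (cos ψ - cos θ))
        + ∫ θ in Ioo 0 π \ {θ | δ < |ψ - θ|}, g θ * Real.cot ((ψ + θ) / 2)) := by
  set S : Set ℝ := {θ | δ < |ψ - θ|} with hS
  have hΩ : MeasurableSet (Ioo 0 π) := measurableSet_Ioo
  have hSm : MeasurableSet S := measurableSet_lt (by fun_prop) (by fun_prop)
  have hneg := Measure.measurePreserving_neg (volume : Measure ℝ)
  have hemb : MeasurableEmbedding (Neg.neg : ℝ → ℝ) := (MeasurableEquiv.neg ℝ).measurableEmbedding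
  have hpre : (Neg.neg : ℝ → ℝ) ⁻¹' Ioo 0 π = Ioo (-π) 0 := by
    ext θ
    simp only [mem_preimage, mem_Ioo]
    constructor <;> rintro ⟨h1, h2⟩ <;> constructor <;> linarith
  have hgneg : IntegrableOn g (Ioo (-π) 0) := by
    have := (hneg.integrableOn_comp_preimage hemb (f := g) (s := Ioo 0 π)).2 hg
    rw [hpre] at this
    exact this.congr_fun (fun θ _ => heven θ) measurableSet_Ioo
  have hsinneg : ∀ θ ∈ Icc (-π) 0, sin ((ψ - θ) / 2) ≠ 0 := fun θ hθ =>
    (sin_pos_of_pos_of_lt_pi (by linarith [hψ.1, hθ.2]) (by linarith [hψ.2, hθ.1])).ne'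
  have hintneg : IntegrableOn (fun θ => g θ * Real.cot ((ψ - θ) / 2)) (Ioo (-π) 0) :=
    integrableOn_mul_cot hgneg measurableSet_Ioo isCompact_Icc Ioo_subset_Icc_self hsinneg
  have hintpos : IntegrableOn (fun θ => g θ * Real.cot ((ψ - θ) / 2)) (Ioo 0 π ∩ S) := by
    refine integrableOn_mul_cot (hg.mono_set inter_subset_left) (hΩ.inter hSm)
      (K := Icc 0 π ∩ {θ | δ ≤ |ψ - θ|})
      (isCompact_Icc.inter_right (isClosed_le (by fun_prop) (by fun_prop)))
      (fun θ hθ => ⟨Ioo_subset_Icc_self hθ.1, (show δ < |ψ - θ| from hθ.2).le⟩) fun θ hθ h => ?_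
    rw [sin_eq_zero_iff_of_lt_of_lt (by linarith [hψ.1, hθ.1.2, pi_pos])
      (by linarith [hψ.2, hθ.1.1, pi_pos])] at h
    have h2 : δ ≤ |ψ - θ| := hθ.2
    rw [show ψ - θ = 0 by linarith, abs_zero] at h2
    linarith
  have hrefl : ∫ θ in Ioo (-π) 0, g θ * Real.cot ((ψ - θ) / 2)
      = ∫ θ in Ioo 0 π, g θ * Real.cot ((ψ + θ) / 2) := by
    rw [← hneg.setIntegral_preimage_emb hemb
      (fun θ => g θ * Real.cot ((ψ + θ) / 2)) (Ioo 0 π), hpre]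
    simp only [heven, sub_eq_add_neg]
  have hcotpos : IntegrableOn (fun θ => g θ * Real.cot ((ψ + θ) / 2)) (Ioo 0 π) := by
    have := (hneg.integrableOn_comp_preimage hemb
      (f := fun θ => g θ * Real.cot ((ψ + θ) / 2)) (s := Ioo 0 π)).1
    rw [hpre] at this
    refine this (hintneg.congr_fun (fun θ _ => ?_) measurableSet_Ioo)
    simp only [Function.comp_apply, heven, sub_eq_add_neg]
  have hset : ({θ : ℝ | θ ∈ Ioo (-π) π ∧ δ < |ψ - θ|} : Set ℝ)
      =ᵐ[volume] (Ioo (-π) 0 ∪ (Ioo 0 π ∩ S) : Set ℝ) := by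
    have h0 : ∀ᵐ θ : ℝ, θ ≠ 0 := by simp [ae_iff]
    filter_upwards [h0] with θ hθ
    refine propext (?_ : θ ∈ Ioo (-π) π ∧ δ < |ψ - θ| ↔ θ ∈ Ioo (-π) 0 ∪ (Ioo 0 π ∩ S))
    constructor
    · rintro ⟨h1, h2⟩
      rcases lt_or_gt_of_ne hθ with h | h
      · exact Or.inl ⟨h1.1, h⟩
      · exact Or.inr ⟨⟨h, h1.2⟩, h2⟩
    · rintro (h | ⟨h, h2⟩)
      · exact ⟨⟨h.1, by linarith [h.2, pi_pos]⟩,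
          (by linarith [h.2] : δ < ψ - θ).trans_le (le_abs_self _)⟩
      · exact ⟨⟨by linarith [h.1, pi_pos], h.2⟩, h2⟩
  have hdisj : Disjoint (Ioo (-π) 0) (Ioo 0 π ∩ S) :=
    disjoint_left.2 fun θ h1 h2 => absurd h1.2 (not_lt.2 h2.1.1.le)
  have hsplit := integral_inter_add_sdiff hSm hcotpos
  have hsum : (∫ θ in Ioo 0 π ∩ S, g θ * Real.cot ((ψ - θ) / 2))
      + ∫ θ in Ioo 0 π ∩ S, g θ * Real.cot ((ψ + θ) / 2)
      = -(2 * sin ψ) * ∫ θ in Ioo 0 π ∩ S, g θ / (cos ψ - cos θ) := by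
    rw [← integral_add hintpos (hcotpos.mono_set inter_subset_left), ← integral_const_mul]
    refine setIntegral_congr_fun (hΩ.inter hSm) fun θ hθ => ?_
    have hne : θ ≠ ψ := by
      rintro rfl
      have h2 : δ < |θ - θ| := hθ.2
      rw [sub_self, abs_zero] at h2
      linarith
    rw [← mul_add, cot_add_cot_half hψ hθ.1 hne]
    ring
  rw [truncatedConjugate, setIntegral_congr_set hset,
    setIntegral_union hdisj (hΩ.inter hSm) hintneg hintpos, hrefl, ← hsplit, ← hsum]
  ring

theorem tendsto_setIntegral_mul_cot_sdiff {ψ : ℝ} (hψ : ψ ∈ Ioo 0 π) {g : ℝ → ℝ}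
    (hg : IntegrableOn g (Ioo 0 π)) :
    Tendsto (fun δ => ∫ θ in Ioo 0 π \ {θ | δ < |ψ - θ|}, g θ * Real.cot ((ψ + θ) / 2))
      (nhdsWithin 0 (Ioi 0)) (nhds 0) := by
  have hint : IntegrableOn (fun θ => g θ * Real.cot ((ψ + θ) / 2)) (Ioo 0 π) := by
    refine hg.mul_continuousOn_of_subset ?_ measurableSet_Ioo isCompact_Icc Ioo_subset_Icc_self
    simp only [Real.cot_eq_cos_div_sin]
    exact ContinuousOn.div (by fun_prop) (by fun_prop) fun θ hθ =>
      (sin_pos_of_pos_of_lt_pi (by linarith [hψ.1, hθ.1]) (by linarith [hψ.2, hθ.2])).ne'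
  have hid : Tendsto (fun δ : ℝ => δ) (nhdsWithin 0 (Ioi 0)) (nhds 0) :=
    tendsto_id.mono_left nhdsWithin_le_nhds
  have hm : ∀ δ, MeasurableSet {θ | δ < |ψ - θ|}ᶜ := fun δ =>
    (measurableSet_lt (by fun_prop) (by fun_prop)).compl
  have hlim := Integrable.tendsto_setIntegral_nhds_zero hint
    (s := fun δ => {θ | δ < |ψ - θ|}ᶜ) (l := nhdsWithin 0 (Ioi 0)) (by
      have hvol : Tendsto (fun δ : ℝ => ENNReal.ofReal (2 * δ)) (nhdsWithin 0 (Ioi 0))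
          (nhds 0) := by
        simpa using ENNReal.tendsto_ofReal (hid.const_mul 2)
      refine tendsto_of_tendsto_of_tendsto_of_le_of_le tendsto_const_nhds hvol
        (fun _ => zero_le) fun δ => ?_
      refine (Measure.restrict_apply_le _ _).trans ?_
      refine (measure_mono (t := Icc (ψ - δ) (ψ + δ)) fun θ hθ => ?_).trans_eq ?_
      · have := abs_le.1 (not_lt.1 (show ¬δ < |ψ - θ| from hθ))
        exact ⟨by linarith, by linarith⟩
      · rw [Real.volume_Icc]
        ring_nf)
  refine hlim.congr fun δ => ?_
  rw [Measure.restrict_restrict (hm δ), Set.sdiff_eq, inter_comm]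

/-- **Coifman–Weiss substitution.** Let `f(x)(1-x²)^{1/4} ∈ L²(-1,1)` and
`g(θ) = f(cos θ)|sin θ|`. For `ψ ∈ (0,π)` and `x = cos ψ`, whenever either
principal value exists,
`(1/π) p.v. ∫_{-1}^1 f(y)/(x-y) dy = −(1/(2 sin ψ)) (1/π) p.v. ∫_{-π}^{π} g(θ) cot((ψ-θ)/2) dθ`;
equivalently, the truncated Hilbert transform tends to `L` iff the truncated
conjugate integral tends to `−2 sin ψ · L`. -/
theorem finiteHilbert_eq_conjugate (f : ℝ → ℝ)
    (hmeas : AEStronglyMeasurable f (volume.restrict (Ioo (-1 : ℝ) 1)))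
    (hL2 : IntegrableOn (fun x => f x ^ 2 * Real.sqrt (1 - x ^ 2)) (Ioo (-1 : ℝ) 1))
    (ψ : ℝ) (hψ : ψ ∈ Ioo 0 π) (L : ℝ) :
    Tendsto (fun ε => truncatedFiniteHilbert f (Real.cos ψ) ε)
        (nhdsWithin 0 (Ioi 0)) (nhds L)
      ↔ Tendsto
          (fun ε => truncatedConjugate (fun θ => f (Real.cos θ) * |Real.sin θ|) ψ ε)
          (nhdsWithin 0 (Ioi 0)) (nhds (-(2 * Real.sin ψ) * L)) := by
  have hs : 0 < sin ψ := sin_pos_of_mem_Ioo hψ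
  set g : ℝ → ℝ := fun θ => f (cos θ) * |sin θ| with hgdef
  have hg : IntegrableOn g (Ioo 0 π) :=
    (integrableOn_Ioo_iff_comp_cos f).1 (integrableOn_Ioo_of_sq_mul_sqrt hmeas hL2)
  have hg2 : IntegrableOn (fun θ => g θ ^ 2) (Ioo 0 π) := by
    simp only [hgdef, sq_comp_cos_mul_abs_sin]
    exact (integrableOn_Ioo_iff_comp_cos _).1 hL2
  have heven : ∀ θ, g (-θ) = g θ := fun θ => by simp [hgdef]
  have hscale : Tendsto (fun ε => truncatedFiniteHilbert f (cos ψ) ε)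
        (nhdsWithin 0 (Ioi 0)) (nhds L)
      ↔ Tendsto (fun δ => truncatedFiniteHilbert f (cos ψ) (δ * sin ψ))
        (nhdsWithin 0 (Ioi 0)) (nhds L) := by
    have hmap : map (fun δ => δ * sin ψ) (nhdsWithin 0 (Ioi 0)) = nhdsWithin 0 (Ioi 0) := by
      have h := comap_mulLeft_nhdsGT_zero hs
      have hsurj : Function.Surjective (fun δ => sin ψ * δ) :=
        (mulLeft_bijective₀ _ hs.ne').surjective
      simp only [mul_comm _ (sin ψ)]
      conv_lhs => rw [← h]
      exact map_comap_of_surjective hsurj _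
    conv_lhs => rw [← hmap, tendsto_map'_iff]
    rfl
  have hdiff : Tendsto (fun δ => truncatedConjugate g ψ δ
      + 2 * sin ψ * truncatedFiniteHilbert f (cos ψ) (δ * sin ψ))
      (nhdsWithin 0 (Ioi 0)) (nhds 0) := by
    have h := (((tendsto_setIntegral_truncations_sub hψ hg hg2).const_mul (-(2 * sin ψ))).add
      (tendsto_setIntegral_mul_cot_sdiff hψ hg)).const_mul (1 / π)
    simp only [mul_zero, add_zero] at h
    refine h.congr' ?_
    filter_upwards [Ioo_mem_nhdsGT hψ.1] with δ hδ
    rw [truncatedConjugate_even hψ heven hg hδ.1 hδ.2, truncatedFiniteHilbert_cos]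
    ring
  rw [hscale]
  constructor <;> intro h
  · refine ((hdiff.sub (h.const_mul (2 * sin ψ))).congr fun δ => ?_).trans_eq ?_
    · ring
    · rw [zero_sub, neg_mul]
  · have h' := (hdiff.sub h).const_mul (2 * sin ψ)⁻¹
    refine (h'.congr fun δ => ?_).trans_eq ?_
    · field_simp
      ring
    · congr 1
      field_simp
      ring
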